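/- arXiv:2301.01506 — 5 statements merged into one kernel-verified Lean document; each statement's English description precedes it below -/
import Mathlib

section
/- Let γ₁ > 1, c > 0, λ ≥ 0, ū = γ₁ c/(γ₁ − 1) and C₁ = ((ū − c)/(1 + λ)) ū^{−γ₁}, and define k(u) = C₁ u^{γ₁} − (u − c)/(1 + λ) for u > 0. Then k(ū) = 0, k′(ū) = 0, and k″(u) > 0 for all u > 0; consequently k(u) > 0 for all u with 0 < u < ū. -/
/-- With `ū = γ₁c/(γ₁−1)` and `C₁ = ((ū−c)/(1+λ)) ū^{−γ₁}`, the function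
`k(u) = C₁ u^{γ₁} − (u−c)/(1+λ)` satisfies `k(ū) = 0`, `k′(ū) = 0` and `k″(u) > 0`
for all `u > 0`; consequently `k(u) > 0` for `0 < u < ū`. -/
theorem dominance_function_positive
    (γ₁ c lam ubar C₁ : ℝ) (hγ : γ₁ > 1) (hc : 0 < c) (hl : 0 ≤ lam)
    (hu : ubar = γ₁ * c / (γ₁ - 1))
    (hC : C₁ = ((ubar - c) / (1 + lam)) * ubar ^ (-γ₁))
    (k : ℝ → ℝ) (hk : ∀ u : ℝ, k u = C₁ * u ^ γ₁ - (u - c) / (1 + lam)) :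
    k ubar = 0 ∧ deriv k ubar = 0
      ∧ (∀ u : ℝ, 0 < u → 0 < deriv (deriv k) u)
      ∧ ∀ u : ℝ, 0 < u → u < ubar → 0 < k u := by
  have hg : 0 < γ₁ - 1 := by linarith
  have hlp : 0 < 1 + lam := by linarith
  have hup : 0 < ubar := by rw [hu]; positivity
  have hsmooth : γ₁ * (ubar - c) = ubar := by rw [hu]; field_simp; ring
  have huc : 0 < ubar - c := by
    by_contra! h
    nlinarith
  have hCp : 0 < C₁ := by rw [hC]; positivity
  have hval : C₁ * ubar ^ γ₁ = (ubar - c) / (1 + lam) := by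
    rw [hC, mul_assoc, ← Real.rpow_add hup, neg_add_cancel, Real.rpow_zero, mul_one]
  have hderiv : deriv k = fun u => C₁ * (γ₁ * u ^ (γ₁ - 1)) - 1 / (1 + lam) := by
    funext u
    rw [funext hk]
    exact (((Real.hasDerivAt_rpow_const (Or.inr hγ.le)).const_mul C₁).sub
      (((hasDerivAt_id u).sub_const c).div_const (1 + lam))).deriv
  have hk0 : k ubar = 0 := by rw [hk, hval, sub_self]
  have hd0 : deriv k ubar = 0 := by
    have h : ubar * (C₁ * (γ₁ * ubar ^ (γ₁ - 1))) = ubar * (1 / (1 + lam)) := by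
      calc ubar * (C₁ * (γ₁ * ubar ^ (γ₁ - 1)))
          = γ₁ * (C₁ * (ubar ^ (γ₁ - 1) * ubar)) := by ring
        _ = γ₁ * (ubar - c) / (1 + lam) := by
            rw [← Real.rpow_add_one hup.ne', sub_add_cancel, hval, mul_div_assoc]
        _ = ubar * (1 / (1 + lam)) := by rw [hsmooth, mul_one_div]
    simp only [hderiv, mul_left_cancel₀ hup.ne' h, sub_self]
  refine ⟨hk0, hd0, fun u hu0 => ?_, fun u hu0 hlt => ?_⟩
  · rw [hderiv, ((((Real.hasDerivAt_rpow_const (p := γ₁ - 1) (Or.inl hu0.ne')).const_mul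
      γ₁).const_mul C₁).sub_const (1 / (1 + lam))).deriv]
    positivity
  · have hcont : Continuous k := by
      rw [funext hk]
      have := Real.continuous_rpow_const (q := γ₁) (by linarith)
      fun_prop
    have hanti : StrictAntiOn k (Set.Icc 0 ubar) := by
      refine strictAntiOn_of_deriv_neg (convex_Icc 0 ubar) hcont.continuousOn fun x hx => ?_
      rw [interior_Icc] at hx
      rw [← hd0]
      simp only [hderiv]
      have := Real.rpow_lt_rpow hx.1.le hx.2 hg
      gcongr
    rw [← hk0]
    exact hanti ⟨hu0.le, hlt.le⟩ ⟨hup.le, le_rfl⟩ hlt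
end

section
/- Let γ₁ > 1, c > 0, λ ≥ 0, ū = γ₁ c/(γ₁ − 1) and C₁ = ((ū − c)/(1 + λ)) ū^{−γ₁}. Then C₁ v^{γ₁} < v/(1 + λ) for every v with 0 < v ≤ ū; consequently, the function k(v) = C₁ v^{γ₁} − (v − c)/(1 + λ) satisfies 0 < k(v) < c/(1 + λ) for all v with 0 < v < ū. -/
/-- With `ū = γ₁c/(γ₁−1)` and `C₁ = ((ū−c)/(1+λ)) ū^{−γ₁}`, one has
`C₁ v^{γ₁} < v/(1+λ)` for `0 < v ≤ ū`; consequently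
`0 < k(v) < c/(1+λ)` for `0 < v < ū`, where `k(v) = C₁ v^{γ₁} − (v−c)/(1+λ)`. -/
theorem value_function_jump_bound
    (γ₁ c lam ubar C₁ : ℝ) (hγ : γ₁ > 1) (hc : 0 < c) (hl : 0 ≤ lam)
    (hu : ubar = γ₁ * c / (γ₁ - 1))
    (hC : C₁ = ((ubar - c) / (1 + lam)) * ubar ^ (-γ₁)) :
    (∀ v : ℝ, 0 < v → v ≤ ubar → C₁ * v ^ γ₁ < v / (1 + lam))
    ∧ ∀ v : ℝ, 0 < v → v < ubar →
        0 < C₁ * v ^ γ₁ - (v - c) / (1 + lam)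
        ∧ C₁ * v ^ γ₁ - (v - c) / (1 + lam) < c / (1 + lam) := by
  have hg : 0 < γ₁ - 1 := by linarith
  have hL : 0 < 1 + lam := by linarith
  have hub : 0 < ubar := by rw [hu]; positivity
  have hsub : γ₁ * (ubar - c) = ubar := by
    rw [hu]
    field_simp
    ring
  have hdiff : 0 < ubar - c := by
    by_contra! h
    nlinarith
  have hform : ∀ v : ℝ, 0 < v → C₁ * v ^ γ₁ = (ubar - c) * (v / ubar) ^ γ₁ / (1 + lam) := by
    intro v hv
    rw [hC, Real.div_rpow hv.le hub.le, Real.rpow_neg hub.le]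
    ring
  have upper : ∀ v : ℝ, 0 < v → v ≤ ubar → C₁ * v ^ γ₁ < v / (1 + lam) := by
    intro v hv hvu
    rw [hform v hv]
    gcongr
    have ht : 0 < v / ubar := by positivity
    have hpow : (v / ubar) ^ γ₁ ≤ v / ubar :=
      Real.rpow_le_self_of_le_one ht.le ((div_le_one hub).2 hvu) hγ.le
    have hv_eq : ubar * (v / ubar) = v := by field_simp
    nlinarith [mul_le_mul_of_nonneg_left hpow hdiff.le, mul_pos hc ht]
  refine ⟨upper, fun v hv hvu => ⟨?_, ?_⟩⟩
  · rw [hform v hv, sub_pos]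
    gcongr
    have ht : 0 < v / ubar := by positivity
    have ht1 : v / ubar < 1 := (div_lt_one hub).2 hvu
    have bernoulli : 1 + γ₁ * (v / ubar - 1) < (1 + (v / ubar - 1)) ^ γ₁ :=
      one_add_mul_self_lt_rpow_one_add (by linarith) (by linarith) hγ
    rw [add_sub_cancel] at bernoulli
    have hv_eq : ubar * (v / ubar) = v := by field_simp
    calc v - c = (ubar - c) * (1 + γ₁ * (v / ubar - 1)) := by
          linear_combination -hv_eq - (v / ubar - 1) * hsub
      _ < (ubar - c) * (v / ubar) ^ γ₁ := mul_lt_mul_of_pos_left bernoulli hdiff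
  · have h := upper v hv hvu.le
    rw [sub_div]
    linarith
end

section
/- Let γ₁ > 1, c > 0, λ ≥ 0, ū = γ₁ c/(γ₁ − 1) and C₁ = ((ū − c)/(1 + λ)) ū^{−γ₁}, and define ψ(v) = C₁ v^{γ₁} for 0 ≤ v < ū and ψ(v) = (v − c)/(1 + λ) for v ≥ ū. Then for every u > c, the supremum of ζ ↦ ψ(u − c − (1 + λ)ζ) + ζ over ζ ∈ [0, (u − c)/(1 + λ)] equals (u − c)/(1 + λ), and it is attained at ζ̂ = (u − c)/(1 + λ). -/
/-- A power with exponent at least one is bounded by its argument on `[0, 1]`,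
in the normalized form `b ^ (-p) * v ^ p ≤ v / b`. -/
theorem rpow_neg_mul_rpow_le_div {p v b : ℝ} (hp : 1 ≤ p) (hv : 0 ≤ v) (hb : 0 < b)
    (hvb : v ≤ b) : b ^ (-p) * v ^ p ≤ v / b := by
  have h : b ^ (-p) * v ^ p = (v / b) ^ p := by
    rw [Real.rpow_neg hb.le, Real.div_rpow hv hb.le, div_eq_mul_inv, mul_comm]
  rw [h]
  exact Real.rpow_le_self_of_le_one (by positivity) ((div_le_one hb).2 hvb) hp

/-- For the candidate value function `ψ` (`ψ(v) = C₁ v^{γ₁}` for `0 ≤ v < ū`,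
`ψ(v) = (v−c)/(1+λ)` for `v ≥ ū`) and every `u > c`, the supremum of
`ζ ↦ ψ(u − c − (1+λ)ζ) + ζ` over `ζ ∈ [0, (u−c)/(1+λ)]` equals `(u−c)/(1+λ)`,
attained at `ζ̂ = (u−c)/(1+λ)`. -/
theorem intervention_operator_value
    (γ₁ c lam ubar C₁ : ℝ) (hγ : γ₁ > 1) (hc : 0 < c) (hl : 0 ≤ lam)
    (hu : ubar = γ₁ * c / (γ₁ - 1))
    (hC : C₁ = ((ubar - c) / (1 + lam)) * ubar ^ (-γ₁))
    (ψ : ℝ → ℝ)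
    (hψ₁ : ∀ v : ℝ, 0 ≤ v → v < ubar → ψ v = C₁ * v ^ γ₁)
    (hψ₂ : ∀ v : ℝ, ubar ≤ v → ψ v = (v - c) / (1 + lam)) :
    ∀ u : ℝ, c < u →
      IsGreatest
        ((fun ζ : ℝ => ψ (u - c - (1 + lam) * ζ) + ζ) ''
          Set.Icc 0 ((u - c) / (1 + lam)))
        ((u - c) / (1 + lam))
      ∧ ψ (u - c - (1 + lam) * ((u - c) / (1 + lam))) + (u - c) / (1 + lam)
          = (u - c) / (1 + lam) := by
  intro u hu'
  have hl1 : 0 < 1 + lam := by linarith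
  have hc_lt : c < ubar := by
    rw [hu, lt_div_iff₀ (by linarith)]
    nlinarith
  have hpos : 0 < ubar := hc.trans hc_lt
  have hψ0 : ψ 0 = 0 := by
    rw [hψ₁ 0 le_rfl hpos, Real.zero_rpow (by linarith), mul_zero]
  have hψ_le : ∀ v : ℝ, 0 ≤ v → ψ v ≤ v / (1 + lam) := by
    intro v hv
    rcases lt_or_ge v ubar with h | h
    · rw [hψ₁ v hv h, hC]
      calc (ubar - c) / (1 + lam) * ubar ^ (-γ₁) * v ^ γ₁
          = (ubar - c) / (1 + lam) * (ubar ^ (-γ₁) * v ^ γ₁) := by ring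
        _ ≤ (ubar - c) / (1 + lam) * (v / ubar) :=
            mul_le_mul_of_nonneg_left (rpow_neg_mul_rpow_le_div hγ.le hv hpos h.le)
              (div_nonneg (by linarith) hl1.le)
        _ ≤ ubar / (1 + lam) * (v / ubar) := by
            gcongr
            linarith
        _ = v / (1 + lam) := by field_simp
    · rw [hψ₂ v h]
      gcongr
      linarith
  have hval : ψ (u - c - (1 + lam) * ((u - c) / (1 + lam))) + (u - c) / (1 + lam)
      = (u - c) / (1 + lam) := by
    rw [mul_div_cancel₀ _ hl1.ne', sub_self, hψ0, zero_add]
  refine ⟨⟨⟨_, ⟨div_nonneg (by linarith) hl1.le, le_rfl⟩, hval⟩, ?_⟩, hval⟩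
  rintro _ ⟨ζ, ⟨-, hζ⟩, rfl⟩
  rw [le_div_iff₀ hl1] at hζ
  calc ψ (u - c - (1 + lam) * ζ) + ζ
      ≤ (u - c - (1 + lam) * ζ) / (1 + lam) + ζ := by
        gcongr
        exact hψ_le _ (by linarith)
    _ = (u - c) / (1 + lam) := by
        field_simp
        ring
end

section
/- Let γ₁ > 1, c > 0, λ ≥ 0, ū = γ₁ c/(γ₁ − 1) and C₁ = ((ū − c)/(1 + λ)) ū^{−γ₁}, and define ψ(v) = C₁ v^{γ₁} for 0 ≤ v < ū and ψ(v) = (v − c)/(1 + λ) for v ≥ ū. Then for every u > c, ψ(u) ≥ sup{ψ(u − c − (1 + λ)ζ) + ζ : 0 ≤ ζ ≤ (u − c)/(1 + λ)}, with equality if and only if u ≥ ū; in particular ψ(u) > Mψ(u) for c < u < ū and ψ(u) = Mψ(u) for u ≥ ū, where Mψ(u) denotes the displayed supremum. -/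
/-- For the candidate value function `ψ` and the intervention operator
`Mψ(u) = sup{ψ(u − c − (1+λ)ζ) + ζ : 0 ≤ ζ ≤ (u−c)/(1+λ)}`, one has, for every
`u > c`, `ψ(u) ≥ Mψ(u)` with equality iff `u ≥ ū`; in particular `ψ(u) > Mψ(u)`
for `c < u < ū` and `ψ(u) = Mψ(u)` for `u ≥ ū`. -/
theorem qvi_condition_ii
    (γ₁ c lam ubar C₁ : ℝ) (hγ : γ₁ > 1) (hc : 0 < c) (hl : 0 ≤ lam)
    (hu : ubar = γ₁ * c / (γ₁ - 1))
    (hC : C₁ = ((ubar - c) / (1 + lam)) * ubar ^ (-γ₁))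
    (ψ : ℝ → ℝ)
    (hψ₁ : ∀ v : ℝ, 0 ≤ v → v < ubar → ψ v = C₁ * v ^ γ₁)
    (hψ₂ : ∀ v : ℝ, ubar ≤ v → ψ v = (v - c) / (1 + lam))
    (Mψ : ℝ → ℝ)
    (hM : ∀ u : ℝ, Mψ u =
      sSup ((fun ζ : ℝ => ψ (u - c - (1 + lam) * ζ) + ζ) ''
        Set.Icc 0 ((u - c) / (1 + lam)))) :
    ∀ u : ℝ, c < u →
      ψ u ≥ Mψ u
      ∧ (ψ u = Mψ u ↔ ubar ≤ u)
      ∧ (u < ubar → Mψ u < ψ u)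
      ∧ (ubar ≤ u → ψ u = Mψ u) := by
  intro u hcu
  have hγ' : 0 < γ₁ - 1 := by linarith
  have hK : 0 < 1 + lam := by linarith
  have hrel : ubar * (γ₁ - 1) = γ₁ * c := by rw [hu]; field_simp
  have hcu' : c < ubar := by nlinarith
  have hpos : 0 < ubar := hc.trans hcu'
  have hψ (v : ℝ) (hv0 : 0 ≤ v) (hv : v < ubar) :
      (1 + lam) * ψ v = (ubar - c) * (v / ubar) ^ γ₁ := by
    rw [hψ₁ v hv0 hv, hC, Real.rpow_neg hpos.le, Real.div_rpow hv0 hpos.le]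
    field_simp
  have hψ_le (v : ℝ) (hv0 : 0 ≤ v) : (1 + lam) * ψ v ≤ v := by
    rcases lt_or_ge v ubar with hv | hv
    · rw [hψ v hv0 hv]
      have ht0 : 0 ≤ v / ubar := by positivity
      have ht1 : v / ubar ≤ 1 := (div_le_one hpos).2 hv.le
      calc (ubar - c) * (v / ubar) ^ γ₁
          ≤ ubar * (v / ubar) := by
            gcongr
            · linarith
            · exact Real.rpow_le_self_of_le_one ht0 ht1 hγ.le
        _ = v := by field_simp
    · rw [hψ₂ v hv, mul_div_cancel₀ _ hK.ne']
      linarith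
  have hψ_gt (v : ℝ) (hv0 : 0 ≤ v) (hv : v < ubar) : (v - c) / (1 + lam) < ψ v := by
    rw [div_lt_iff₀' hK, hψ v hv0 hv]
    have ht0 : 0 ≤ v / ubar := by positivity
    have ht1 : v / ubar < 1 := (div_lt_one hpos).2 hv
    have hb := one_add_mul_self_lt_rpow_one_add (s := v / ubar - 1) (by linarith)
      (by linarith) hγ
    rw [add_sub_cancel] at hb
    calc v - c = (ubar - c) * (1 + γ₁ * (v / ubar - 1)) := by
          field_simp
          linear_combination (ubar - v) * hrel
      _ < (ubar - c) * (v / ubar) ^ γ₁ := by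
          gcongr
  have hMu : Mψ u = (u - c) / (1 + lam) := by
    rw [hM]
    refine IsGreatest.csSup_eq ⟨⟨(u - c) / (1 + lam), ?_, ?_⟩, ?_⟩
    · exact ⟨div_nonneg (by linarith) hK.le, le_rfl⟩
    · simp only [mul_div_cancel₀ _ hK.ne', sub_self]
      rw [hψ₁ 0 le_rfl hpos, Real.zero_rpow (by linarith), mul_zero, zero_add]
    · rintro _ ⟨ζ, ⟨-, hζ⟩, rfl⟩
      rw [le_div_iff₀' hK] at hζ ⊢
      have := hψ_le (u - c - (1 + lam) * ζ) (by linarith)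
      linarith
  rw [hMu]
  have hlt (h : u < ubar) : (u - c) / (1 + lam) < ψ u := hψ_gt u (hc.trans hcu).le h
  refine ⟨?_, ⟨fun h => ?_, hψ₂ u⟩, hlt, hψ₂ u⟩
  · rcases lt_or_ge u ubar with h | h
    · exact (hlt h).le
    · exact (hψ₂ u h).ge
  · by_contra! h'
    exact (hlt h').ne' h
end

section
/- Let c > 0, λ ≥ 0, γ₁ > 1, ū = γ₁ c/(γ₁ − 1), C₁ = ((ū − c)/(1 + λ)) ū^{−γ₁}, and define k(v) = C₁ v^{γ₁} − (v − c)/(1 + λ). Let ρ > 0 and α₀ be real, let ν be a finite (nonnegative) measure on ℝ, let S ⊆ ℝ be a measurable set, and let G : ℝ → ℝ be measurable with 0 < G(z) < ū for all z ∈ S. Then for every u > ū, −ρ (u − c)/(1 + λ) + α₀ u/(1 + λ) + ∫_S k(G(z)) ν(dz) ≤ (1 + λ)^{−1} [ (α₀ − ρ) u + (ρ + ν(ℝ)) c ]. -/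
open MeasureTheory

/-- Below the smooth-fit boundary `γ c / (γ - 1)`, the difference between the power solution
matched at the boundary and the net payout lies in `[0, c / (1 + lam)]`. -/
theorem smooth_fit_gap_mem_Icc {γ c lam b v : ℝ} (hγ : 1 < γ) (hc : 0 < c) (hl : 0 ≤ lam)
    (hb : b = γ * c / (γ - 1)) (hv : 0 < v) (hvb : v < b) :
    (b - c) / (1 + lam) * b ^ (-γ) * v ^ γ - (v - c) / (1 + lam) ∈
      Set.Icc 0 (c / (1 + lam)) := by
  have hγ' : 0 < γ - 1 := sub_pos.2 hγ
  have hl' : 0 < 1 + lam := by linarith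
  have hb0 : 0 < b := hv.trans hvb
  have hbc : (b - c) * (γ - 1) = c := by rw [hb]; field_simp; ring
  have hbc0 : 0 < b - c := pos_of_mul_pos_left (hbc.symm ▸ hc) hγ'.le
  have ht0 : 0 < v / b := div_pos hv hb0
  have ht1 : v / b ≤ 1 := (div_le_one hb0).2 hvb.le
  have hvt : v = v / b * b := by field_simp
  have hpow : b ^ (-γ) * v ^ γ = (v / b) ^ γ := by
    rw [Real.div_rpow hv.le hb0.le, Real.rpow_neg hb0.le]; ring
  have hgap : (b - c) / (1 + lam) * b ^ (-γ) * v ^ γ - (v - c) / (1 + lam)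
      = ((b - c) * (v / b) ^ γ - (v - c)) / (1 + lam) := by
    rw [mul_assoc, hpow]; ring
  have hle : (v / b) ^ γ ≤ v / b := by
    simpa using Real.rpow_le_rpow_of_exponent_ge ht0 ht1 hγ.le
  have hge : 1 + γ * (v / b - 1) ≤ (v / b) ^ γ := by
    simpa using one_add_mul_self_le_rpow_one_add (s := v / b - 1) (by linarith) hγ.le
  generalize v / b = t at *
  rw [hgap]
  refine ⟨div_nonneg ?_ hl'.le, div_le_div_of_nonneg_right ?_ hl'.le⟩
  · have hbγ : b = (b - c) * γ := by linarith
    have h := mul_le_mul_of_nonneg_left hge hbc0.le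
    have htb : t * b = t * ((b - c) * γ) := congrArg (t * ·) hbγ
    linarith
  · have h := mul_le_mul_of_nonneg_left hle hbc0.le
    have := mul_pos ht0 hc
    linarith

/-- Estimate of the generator applied to the candidate value function outside the
continuation region: for `u > ū`,
`−ρ(u−c)/(1+λ) + α₀u/(1+λ) + ∫_S k(G(z)) ν(dz)
  ≤ (1+λ)⁻¹[(α₀−ρ)u + (ρ + ‖ν‖)c]`,
where `k(v) = C₁ v^{γ₁} − (v−c)/(1+λ)`, `ν` is a finite measure, and the post-jump
state `G(z)` lies in `(0, ū)` for `z ∈ S`. -/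
theorem generator_estimate_outside_continuation
    (γ₁ c lam ubar C₁ ρ α₀ : ℝ) (hγ : γ₁ > 1) (hc : 0 < c) (hl : 0 ≤ lam)
    (hu : ubar = γ₁ * c / (γ₁ - 1))
    (hC : C₁ = ((ubar - c) / (1 + lam)) * ubar ^ (-γ₁))
    (hρ : 0 < ρ)
    (k : ℝ → ℝ) (hk : ∀ v : ℝ, k v = C₁ * v ^ γ₁ - (v - c) / (1 + lam))
    (ν : Measure ℝ) [IsFiniteMeasure ν]
    (S : Set ℝ) (hS : MeasurableSet S)
    (G : ℝ → ℝ) (hG : Measurable G)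
    (hGS : ∀ z ∈ S, 0 < G z ∧ G z < ubar) :
    ∀ u : ℝ, ubar < u →
      -ρ * (u - c) / (1 + lam) + α₀ * u / (1 + lam) + ∫ z in S, k (G z) ∂ν
        ≤ (1 + lam)⁻¹ * ((α₀ - ρ) * u + (ρ + (ν Set.univ).toReal) * c) := by
  intro u _
  have hl' : 0 < 1 + lam := by linarith
  have hbound : ∀ z ∈ S, ‖k (G z)‖ ≤ c / (1 + lam) := fun z hz => by
    obtain ⟨h0, h1⟩ := smooth_fit_gap_mem_Icc hγ hc hl hu (hGS z hz).1 (hGS z hz).2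
    rw [← hC, ← hk] at h0 h1
    rwa [Real.norm_of_nonneg h0]
  have hint : ∫ z in S, k (G z) ∂ν ≤ c / (1 + lam) * (ν Set.univ).toReal :=
    calc ∫ z in S, k (G z) ∂ν
        ≤ ‖∫ z in S, k (G z) ∂ν‖ := Real.le_norm_self _
      _ ≤ c / (1 + lam) * ν.real S :=
        norm_setIntegral_le_of_norm_le_const (measure_lt_top ν S) hbound
      _ ≤ c / (1 + lam) * (ν Set.univ).toReal :=
        mul_le_mul_of_nonneg_left (measureReal_mono (Set.subset_univ S)) (div_nonneg hc.le hl'.le)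
  calc -ρ * (u - c) / (1 + lam) + α₀ * u / (1 + lam) + ∫ z in S, k (G z) ∂ν
      ≤ -ρ * (u - c) / (1 + lam) + α₀ * u / (1 + lam) + c / (1 + lam) * (ν Set.univ).toReal := by
        gcongr
    _ = (1 + lam)⁻¹ * ((α₀ - ρ) * u + (ρ + (ν Set.univ).toReal) * c) := by ring
end
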